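/- (Proposition: formula for the specific energy.) Let u ∈ 𝒰 and let ρ : ℝᵈ × ℝᵈ → [0,∞) be measurable, bounded by a constant ξ > 0, and translation invariant (ρ(x+z,y+z) = ρ(x,y) for all x,y,z). Then the limit lim_{ℓ→∞} (1/(2|Λ_ℓ|)) ∫_{Λ_ℓ × Λ_ℓ} u(x−y) ρ(x,y) d(x,y) exists in ℝ ∪ {+∞} and equals (1/2) ∫_{ℝᵈ} u(y) ρ(y,0) dy, where both the double integrals and the right-hand side are understood as extended-valued integrals ∫ max(·,0) − ∫ max(−·,0) (the negative parts being finite since the negative part of u is integrable over ℝᵈ by the defining conditions of 𝒰). -/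

import Mathlib

open MeasureTheory ENNReal Filter

/-- The box `Λ_ℓ = [-ℓ,ℓ]^d ⊂ ℝᵈ`. -/
def lam (d : ℕ) (ℓ : ℝ) : Set (EuclideanSpace ℝ (Fin d)) := {x | ∀ i, |x i| ≤ ℓ}

/-- The class 𝒰 of pair potentials: even measurable functions `u : ℝᵈ → ℝ ∪ {+∞}`
with a decreasing, non-integrable lower bound `φ` near the origin and a decreasing,
integrable majorant `ψ` of `|u|` away from the origin. -/
def memU (d : ℕ) (u : EuclideanSpace ℝ (Fin d) → EReal) : Prop :=
  Measurable u ∧ (∀ x, u (-x) = u x) ∧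
  ∃ r₀ : ℝ, 0 < r₀ ∧
    (∃ φ : ℝ → ℝ,
      (∀ r ∈ Set.Ioc (0 : ℝ) r₀, 0 ≤ φ r) ∧
      AntitoneOn φ (Set.Ioc 0 r₀) ∧
      (∫⁻ r in Set.Ioc (0 : ℝ) r₀, ENNReal.ofReal (r ^ (d - 1) * φ r)) = ⊤ ∧
      (∀ x : EuclideanSpace ℝ (Fin d), 0 < ‖x‖ → ‖x‖ ≤ r₀ → ((φ ‖x‖ : ℝ) : EReal) ≤ u x)) ∧
    (∃ ψ : ℝ → ℝ,
      (∀ r, r₀ ≤ r → 0 ≤ ψ r) ∧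
      AntitoneOn ψ (Set.Ici r₀) ∧
      (∫⁻ r in Set.Ici r₀, ENNReal.ofReal (r ^ (d - 1) * ψ r)) < ⊤ ∧
      (∀ x : EuclideanSpace ℝ (Fin d), r₀ ≤ ‖x‖ → (u x).abs ≤ ENNReal.ofReal (ψ ‖x‖)))

/-- The positive part `max(a, 0)` of an extended real, as an element of `ℝ≥0∞`. -/
noncomputable def eposPart (a : EReal) : ℝ≥0∞ := (a ⊔ 0).abs

/-- The negative part `max(-a, 0)` of an extended real, as an element of `ℝ≥0∞`. -/
noncomputable def enegPart (a : EReal) : ℝ≥0∞ := (-a ⊔ 0).abs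

/-- `∫_{Λ_ℓ × Λ_ℓ} max(u(x-y), 0) ρ(x,y) d(x,y)`. -/
noncomputable def iPos {d : ℕ} (u : EuclideanSpace ℝ (Fin d) → EReal)
    (ρ : EuclideanSpace ℝ (Fin d) × EuclideanSpace ℝ (Fin d) → ℝ) (ℓ : ℝ) : ℝ≥0∞ :=
  ∫⁻ p in (lam d ℓ) ×ˢ (lam d ℓ), eposPart (u (p.1 - p.2)) * ENNReal.ofReal (ρ p)

/-- `∫_{Λ_ℓ × Λ_ℓ} max(-u(x-y), 0) ρ(x,y) d(x,y)`. -/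
noncomputable def iNeg {d : ℕ} (u : EuclideanSpace ℝ (Fin d) → EReal)
    (ρ : EuclideanSpace ℝ (Fin d) × EuclideanSpace ℝ (Fin d) → ℝ) (ℓ : ℝ) : ℝ≥0∞ :=
  ∫⁻ p in (lam d ℓ) ×ˢ (lam d ℓ), enegPart (u (p.1 - p.2)) * ENNReal.ofReal (ρ p)

lemma eposPart_eq_toENNReal (a : EReal) : eposPart a = a.toENNReal := by
  unfold eposPart
  induction a with
  | bot => simp
  | top => simp
  | coe r =>
    rcases le_total 0 r with h | h
    · rw [sup_eq_left.2 (EReal.coe_nonneg.2 h), EReal.abs_def, abs_of_nonneg h,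
        EReal.real_coe_toENNReal]
    · have h' : (r : EReal) ≤ 0 := EReal.coe_nonpos.2 h
      rw [sup_eq_right.2 h', EReal.abs_zero, EReal.toENNReal_of_nonpos h']

lemma enegPart_eq_toENNReal_neg (a : EReal) : enegPart a = (-a).toENNReal :=
  eposPart_eq_toENNReal (-a)

lemma enegPart_le_abs (a : EReal) : enegPart a ≤ a.abs := by
  rw [enegPart_eq_toENNReal_neg]
  induction a with
  | bot => simp
  | top => simp
  | coe r =>
    rw [← EReal.coe_neg, EReal.real_coe_toENNReal, EReal.abs_def]
    exact ENNReal.ofReal_le_ofReal (neg_le_abs r)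

lemma measurableSet_lam (d : ℕ) (ℓ : ℝ) : MeasurableSet (lam d ℓ) := by
  have : lam d ℓ = ⋂ i, {x : EuclideanSpace ℝ (Fin d) | |x i| ≤ ℓ} := by
    ext x; simp [lam]
  rw [this]
  exact MeasurableSet.iInter fun i => measurableSet_le (by fun_prop) measurable_const

lemma volume_lam (d : ℕ) (ℓ : ℝ) : volume (lam d ℓ) = ENNReal.ofReal (2 * ℓ) ^ d := by
  have h : lam d ℓ = (@WithLp.ofLp 2 (Fin d → ℝ)) ⁻¹'
      Set.Icc (fun _ => -ℓ) (fun _ => ℓ) := by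
    ext x
    simp [lam, abs_le, Pi.le_def, forall_and]
  rw [h, (PiLp.volume_preserving_ofLp (Fin d)).measure_preimage
    measurableSet_Icc.nullMeasurableSet, Real.volume_Icc_pi]
  simp [two_mul]

lemma setLIntegral_prod_sub_eq {d : ℕ} {s : Set (EuclideanSpace ℝ (Fin d))}
    (hs : MeasurableSet s) {f : EuclideanSpace ℝ (Fin d) → ℝ≥0∞} (hf : Measurable f) :
    ∫⁻ p in s ×ˢ s, f (p.1 - p.2) = ∫⁻ z, volume {x | x ∈ s ∧ x - z ∈ s} * f z := by
  have hg : Measurable ((s ×ˢ s).indicator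
      fun p : EuclideanSpace ℝ (Fin d) × EuclideanSpace ℝ (Fin d) => f (p.1 - p.2)) :=
    (hf.comp (by fun_prop)).indicator (hs.prod hs)
  rw [← lintegral_indicator (hs.prod hs), Measure.volume_eq_prod,
    lintegral_prod _ hg.aemeasurable]
  simp_rw [fun x : EuclideanSpace ℝ (Fin d) => (lintegral_sub_left_eq_self
    (μ := (volume : Measure (EuclideanSpace ℝ (Fin d))))
    (fun y => (s ×ˢ s).indicator (fun p => f (p.1 - p.2)) (x, y)) x).symm]
  have hg' : Measurable (Function.uncurry fun x z : EuclideanSpace ℝ (Fin d) =>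
      (s ×ˢ s).indicator (fun p => f (p.1 - p.2)) (x, x - z)) :=
    hg.comp (measurable_fst.prodMk (measurable_fst.sub measurable_snd))
  rw [lintegral_lintegral_swap hg'.aemeasurable]
  refine lintegral_congr fun z => ?_
  have hm : MeasurableSet {x | x ∈ s ∧ x - z ∈ s} :=
    hs.inter (hs.preimage (measurable_id.sub_const z))
  rw [mul_comm, ← lintegral_indicator_const hm]
  refine lintegral_congr fun x => ?_
  by_cases hx : x ∈ s ∧ x - z ∈ s
  · rw [Set.indicator_of_mem (Set.mk_mem_prod hx.1 hx.2), Set.indicator_of_mem (by exact hx)]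
    simp only [_root_.sub_sub_cancel]
  · rw [Set.indicator_of_notMem fun h => hx (Set.mem_prod.1 h),
      Set.indicator_of_notMem (by exact hx)]

lemma measurable_volume_inter_translate {d : ℕ} {s : Set (EuclideanSpace ℝ (Fin d))}
    (hs : MeasurableSet s) :
    Measurable fun z => volume {x | x ∈ s ∧ x - z ∈ s} := by
  have hm : MeasurableSet {q : EuclideanSpace ℝ (Fin d) × EuclideanSpace ℝ (Fin d) |
      q.2 ∈ s ∧ q.2 - q.1 ∈ s} :=
    (hs.preimage measurable_snd).inter (hs.preimage (measurable_snd.sub measurable_fst))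
  exact measurable_measure_prodMk_left hm

lemma tendsto_volume_lam_inter_translate_div {d : ℕ} (z : EuclideanSpace ℝ (Fin d)) :
    Tendsto (fun ℓ : ℝ => volume {x | x ∈ lam d ℓ ∧ x - z ∈ lam d ℓ} / volume (lam d ℓ))
      atTop (nhds 1) := by
  have hlow : Tendsto (fun ℓ : ℝ => ENNReal.ofReal (1 - ‖z‖ / ℓ) ^ d) atTop (nhds 1) := by
    have h : Tendsto (fun ℓ : ℝ => 1 - ‖z‖ / ℓ) atTop (nhds (1 - 0)) :=
      tendsto_const_nhds.sub (tendsto_const_nhds.div_atTop tendsto_id)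
    simpa using ENNReal.Tendsto.pow (n := d) (ENNReal.tendsto_ofReal h)
  refine tendsto_of_tendsto_of_tendsto_of_le_of_le' hlow tendsto_const_nhds ?_ ?_
  · filter_upwards [eventually_gt_atTop 0] with ℓ hℓ
    have hsub : lam d (ℓ - ‖z‖) ⊆ {x | x ∈ lam d ℓ ∧ x - z ∈ lam d ℓ} := by
      intro x hx
      refine ⟨fun i => ?_, fun i => ?_⟩
      · linarith [hx i, norm_nonneg z]
      · have h1 : |z i| ≤ ‖z‖ := PiLp.norm_apply_le z i
        have h2 := abs_sub (x i) (z i)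
        simp only [PiLp.sub_apply]
        linarith [hx i]
    calc ENNReal.ofReal (1 - ‖z‖ / ℓ) ^ d
        = volume (lam d (ℓ - ‖z‖)) / volume (lam d ℓ) := by
          rw [volume_lam, volume_lam, ENNReal.div_eq_inv_mul (b := _ ^ d), ENNReal.inv_pow,
            ← mul_pow, ← ENNReal.div_eq_inv_mul,
            ← ENNReal.ofReal_div_of_pos (by positivity)]
          congr 2
          field_simp
      _ ≤ _ := by gcongr
  · refine Eventually.of_forall fun ℓ => ENNReal.div_le_of_le_mul ?_
    rw [one_mul]
    exact measure_mono fun x hx => hx.1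

/-- Averages over `Λ_ℓ × Λ_ℓ` of a function of the difference converge to the full integral,
including when that integral is infinite. -/
lemma tendsto_setLIntegral_lam_prod_sub_div {d : ℕ} {f : EuclideanSpace ℝ (Fin d) → ℝ≥0∞}
    (hf : Measurable f) :
    Tendsto (fun ℓ : ℝ => (∫⁻ p in lam d ℓ ×ˢ lam d ℓ, f (p.1 - p.2)) / volume (lam d ℓ))
      atTop (nhds (∫⁻ z, f z)) := by
  have heq (ℓ : ℝ) : (∫⁻ p in lam d ℓ ×ˢ lam d ℓ, f (p.1 - p.2)) / volume (lam d ℓ) =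
      ∫⁻ z, volume {x | x ∈ lam d ℓ ∧ x - z ∈ lam d ℓ} / volume (lam d ℓ) * f z := by
    have hm : Measurable fun z => volume {x | x ∈ lam d ℓ ∧ x - z ∈ lam d ℓ} * f z :=
      (measurable_volume_inter_translate (measurableSet_lam d ℓ)).mul hf
    rw [setLIntegral_prod_sub_eq (measurableSet_lam d ℓ) hf, div_eq_mul_inv, mul_comm,
      ← lintegral_const_mul _ hm]
    refine lintegral_congr fun z => ?_
    rw [div_eq_mul_inv, ← mul_assoc, mul_comm (volume (lam d ℓ))⁻¹]
  simp_rw [heq]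
  refine tendsto_of_le_liminf_of_limsup_le ?_ ?_
  · calc ∫⁻ z, f z
        = ∫⁻ z, liminf (fun ℓ : ℝ =>
            volume {x | x ∈ lam d ℓ ∧ x - z ∈ lam d ℓ} / volume (lam d ℓ) * f z) atTop := by
          refine lintegral_congr fun z => Eq.symm (Tendsto.liminf_eq ?_)
          simpa using ENNReal.Tendsto.mul_const (b := f z)
            (tendsto_volume_lam_inter_translate_div z) (Or.inl one_ne_zero)
      _ ≤ _ := lintegral_liminf_le fun ℓ =>
          ((measurable_volume_inter_translate (measurableSet_lam d ℓ)).div_const _).mul hf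
  · refine limsup_le_of_le (h := Eventually.of_forall fun ℓ => lintegral_mono fun z => ?_)
    refine mul_le_of_le_one_left zero_le ?_
    refine ENNReal.div_le_of_le_mul ?_
    rw [one_mul]
    exact measure_mono fun x hx => hx.1

/-- The negative part of a potential in `𝒰` is integrable. -/
lemma lintegral_enegPart_lt_top {d : ℕ} (hd : 1 ≤ d) {u : EuclideanSpace ℝ (Fin d) → EReal}
    (hu : memU d u) : ∫⁻ y, enegPart (u y) < ⊤ := by
  obtain ⟨-, -, r₀, hr₀, ⟨φ, hφ0, -, -, hφ⟩, ψ, hψ0, hψanti, hψint, hψ⟩ := hu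
  have : Nonempty (Fin d) := ⟨⟨0, hd⟩⟩
  have hψm : AEMeasurable ψ (volume.restrict (Set.Ici r₀)) :=
    aemeasurable_restrict_of_antitoneOn measurableSet_Ici hψanti
  have h1 : IntegrableOn (fun r : ℝ => r ^ (d - 1) * ψ r) (Set.Ici r₀) := by
    refine ⟨((measurable_id.pow_const (d - 1)).aemeasurable.mul hψm).aestronglyMeasurable, ?_⟩
    rw [hasFiniteIntegral_iff_ofReal]
    · exact hψint
    · filter_upwards [ae_restrict_mem measurableSet_Ici] with r hr
      have h0 : 0 ≤ r := hr₀.le.trans hr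
      have := hψ0 r hr
      change 0 ≤ r ^ (d - 1) * ψ r
      positivity
  have h2 : Integrable (fun x : EuclideanSpace ℝ (Fin d) => (Set.Ici r₀).indicator ψ ‖x‖) := by
    rw [integrable_fun_norm_addHaar volume (f := (Set.Ici r₀).indicator ψ),
      finrank_euclideanSpace_fin]
    have h3 : (fun r : ℝ => r ^ (d - 1) • (Set.Ici r₀).indicator ψ r) =
        (Set.Ici r₀).indicator fun r => r ^ (d - 1) * ψ r := by
      ext r; by_cases hr : r ∈ Set.Ici r₀ <;> simp [Set.indicator, hr]
    rw [h3]
    exact ((integrable_indicator_iff measurableSet_Ici).2 h1).integrableOn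
  refine lt_of_le_of_lt (lintegral_mono_ae ?_) h2.lintegral_lt_top
  filter_upwards [Measure.ae_ne volume (0 : EuclideanSpace ℝ (Fin d))] with x hx
  rcases le_or_gt r₀ ‖x‖ with h | h
  · rw [Set.indicator_of_mem (Set.mem_Ici.2 h)]
    exact (enegPart_le_abs _).trans (hψ x h)
  · have hx0 : 0 < ‖x‖ := norm_pos_iff.2 hx
    have hux : 0 ≤ u x :=
      (EReal.coe_nonneg.2 (hφ0 ‖x‖ ⟨hx0, h.le⟩)).trans (hφ x hx0 h.le)
    rw [enegPart_eq_toENNReal_neg, EReal.toENNReal_of_nonpos (by simpa using hux)]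
    exact zero_le

/-- Formula for the specific energy: for `u ∈ 𝒰` and a bounded translation invariant
pair density `ρ`, the limit `lim_{ℓ→∞} (1/(2|Λ_ℓ|)) ∫_{Λ_ℓ × Λ_ℓ} u(x-y) ρ(x,y) d(x,y)`
exists in `ℝ ∪ {+∞}` and equals `(1/2) ∫_{ℝᵈ} u(y) ρ(y,0) dy`, all extended-valued
integrals being understood as `∫ max(·,0) - ∫ max(-·,0)` (the negative parts being
finite by the defining conditions on 𝒰); `|Λ_ℓ| = (2ℓ)^d`. -/
theorem specific_energy_formula {d : ℕ} (hd : 1 ≤ d)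
    (u : EuclideanSpace ℝ (Fin d) → EReal) (hu : memU d u)
    (ξ : ℝ) (hξ : 0 < ξ)
    (ρ : EuclideanSpace ℝ (Fin d) × EuclideanSpace ℝ (Fin d) → ℝ)
    (hρmeas : Measurable ρ) (hρnonneg : ∀ p, 0 ≤ ρ p) (hρbound : ∀ p, ρ p ≤ ξ)
    (hti : ∀ x y z : EuclideanSpace ℝ (Fin d), ρ (x + z, y + z) = ρ (x, y)) :
    Tendsto (fun ℓ : ℝ =>
        ((((2 * (2 * ℓ) ^ d)⁻¹ : ℝ)) : EReal) *
          ((iPos u ρ ℓ : EReal) - (iNeg u ρ ℓ : EReal)))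
      atTop
      (nhds ((((2⁻¹ : ℝ)) : EReal) *
        (((∫⁻ y, eposPart (u y) * ENNReal.ofReal (ρ (y, 0))) : EReal) -
          ((∫⁻ y, enegPart (u y) * ENNReal.ofReal (ρ (y, 0))) : EReal)))) := by
  have hρ (p : EuclideanSpace ℝ (Fin d) × EuclideanSpace ℝ (Fin d)) :
      ρ p = ρ (p.1 - p.2, 0) := by
    have := hti (p.1 - p.2) 0 p.2
    simpa using this
  have hρ0 : Measurable fun y => ENNReal.ofReal (ρ (y, 0)) := by fun_prop
  have hpm : Measurable fun y => eposPart (u y) * ENNReal.ofReal (ρ (y, 0)) := by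
    simp_rw [eposPart_eq_toENNReal]
    exact hu.1.ereal_toENNReal.mul hρ0
  have hnm : Measurable fun y => enegPart (u y) * ENNReal.ofReal (ρ (y, 0)) := by
    simp_rw [enegPart_eq_toENNReal_neg]
    exact hu.1.neg.ereal_toENNReal.mul hρ0
  have hP := tendsto_setLIntegral_lam_prod_sub_div hpm
  have hN := tendsto_setLIntegral_lam_prod_sub_div hnm
  have hiP (ℓ : ℝ) : iPos u ρ ℓ = ∫⁻ p in lam d ℓ ×ˢ lam d ℓ,
      eposPart (u (p.1 - p.2)) * ENNReal.ofReal (ρ (p.1 - p.2, 0)) :=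
    lintegral_congr fun p => by rw [hρ p]
  have hiN (ℓ : ℝ) : iNeg u ρ ℓ = ∫⁻ p in lam d ℓ ×ˢ lam d ℓ,
      enegPart (u (p.1 - p.2)) * ENNReal.ofReal (ρ (p.1 - p.2, 0)) :=
    lintegral_congr fun p => by rw [hρ p]
  simp_rw [← hiP] at hP
  simp_rw [← hiN] at hN
  have hfin : ∫⁻ y, enegPart (u y) * ENNReal.ofReal (ρ (y, 0)) ≠ ⊤ := by
    refine ne_top_of_le_ne_top (ENNReal.mul_ne_top (lintegral_enegPart_lt_top hd hu).ne
      (ENNReal.ofReal_ne_top (r := ξ))) ?_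
    rw [← lintegral_mul_const' _ _ ENNReal.ofReal_ne_top]
    exact lintegral_mono fun y => by gcongr; exact hρbound _
  have hsub := (EReal.continuousAt_add
      (p := (((∫⁻ y, eposPart (u y) * ENNReal.ofReal (ρ (y, 0)) : ℝ≥0∞) : EReal),
        -((∫⁻ y, enegPart (u y) * ENNReal.ofReal (ρ (y, 0)) : ℝ≥0∞) : EReal)))
      (Or.inr (by simpa [EReal.neg_eq_bot_iff] using hfin))
      (Or.inl (EReal.coe_ennreal_ne_bot _))).tendsto.comp
    ((EReal.tendsto_coe_ennreal.2 hP).prodMk_nhds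
      ((continuous_neg.tendsto _).comp (EReal.tendsto_coe_ennreal.2 hN)))
  refine Tendsto.congr' ?_ (EReal.Tendsto.const_mul (a := ((2⁻¹ : ℝ) : EReal)) hsub
    (Or.inl (EReal.coe_ne_bot _)) (Or.inl (EReal.coe_ne_top _)))
  filter_upwards [eventually_gt_atTop 0] with ℓ hℓ
  have hdiv (A : ℝ≥0∞) : ((A / volume (lam d ℓ) : ℝ≥0∞) : EReal) =
      ((((2 * ℓ) ^ d)⁻¹ : ℝ) : EReal) * (A : EReal) := by
    rw [volume_lam, ← ENNReal.ofReal_pow (by positivity), div_eq_mul_inv,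
      ← ENNReal.ofReal_inv_of_pos (by positivity), EReal.coe_ennreal_mul,
      EReal.coe_ennreal_ofReal, max_eq_left (by positivity), mul_comm]
  simp only [Function.comp_apply]
  rw [hdiv, hdiv, ← sub_eq_add_neg,
    ← EReal.mul_sub_of_nonneg_of_ne_top (EReal.coe_nonneg.2 (by positivity))
      (EReal.coe_ne_top _),
    ← mul_assoc, ← EReal.coe_mul, ← mul_inv]
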